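/- For every probability measure μ on (Set H, 𝔅), the family of restrictions { μ|b : b ⊆ H finite } is ⊑-directed, each restriction satisfies μ|b ⊑ μ, and μ is the ⊑-supremum of this family: for every Scott-open U, μ(U) = ⨆_{b finite} (μ|b)(U). In particular, every probability measure on (Set H, 𝔅) is the directed supremum of finite discrete measures. -/

import Mathlib

open MeasureTheory Set ENNReal

/-- A set of subsets of `H` is Scott-open if it is an upper set for inclusion and
meets every directed family of subsets whose union it contains. -/
def ScottOpen {H : Type*} (U : Set (Set H)) : Prop :=
  (∀ ⦃a b : Set H⦄, a ⊆ b → a ∈ U → b ∈ U) ∧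
  ∀ D : Set (Set H), D.Nonempty → DirectedOn (· ⊆ ·) D → ⋃₀ D ∈ U → (D ∩ U).Nonempty

/-- The Borel σ-algebra on `Set H` generated by the Scott-open sets. -/
def scottBorel (H : Type*) : MeasurableSpace (Set H) :=
  MeasurableSpace.generateFrom {U : Set (Set H) | ScottOpen U}

/-- The order `μ ⊑ ν` on measures: `μ U ≤ ν U` for every Scott-open `U`. -/
def MeasLE {H : Type*} (μ ν : @Measure (Set H) (scottBorel H)) : Prop :=
  ∀ U : Set (Set H), ScottOpen U → μ U ≤ ν U

/-- The atom `A_{a,b} = {c | c ∩ b = a}`. -/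
def Atom {H : Type*} (a b : Set H) : Set (Set H) := {c | c ∩ b = a}

/-- The restriction `μ|b` of a measure `μ` to a finite set `b`:
the finite discrete measure `∑_{a ⊆ b} μ(A_{a,b}) · δ_a`. -/
noncomputable def restrictMeas {H : Type*} [DecidableEq H]
    (μ : @Measure (Set H) (scottBorel H)) (b : Finset H) :
    @Measure (Set H) (scottBorel H) :=
  ∑ a ∈ b.powerset,
    μ (Atom (↑a) (↑b)) • @Measure.dirac (Set H) (scottBorel H) (↑a : Set H)

theorem scottOpen_setOf_mem {H : Type*} (x : H) : ScottOpen {c : Set H | x ∈ c} := by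
  refine ⟨fun a b hab ha => hab ha, ?_⟩
  rintro D - - ⟨d, hd, hx⟩
  exact ⟨d, hd, hx⟩

theorem ScottOpen.measurableSet {H : Type*} {U : Set (Set H)} (hU : ScottOpen U) :
    @MeasurableSet (Set H) (scottBorel H) U :=
  MeasurableSpace.measurableSet_generateFrom hU

theorem measurableSet_atom {H : Type*} (a b : Finset H) :
    @MeasurableSet (Set H) (scottBorel H) (Atom (↑a) (↑b)) := by
  let _ := scottBorel H
  by_cases hab : a ⊆ b
  · have h : Atom (a : Set H) (b : Set H) = ⋂ x ∈ b, {c : Set H | x ∈ c ↔ x ∈ a} := by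
      ext c
      simp only [Atom, mem_ofPred_eq, mem_iInter, Set.ext_iff, mem_inter_iff, Finset.mem_coe]
      constructor
      · intro h x hx
        simpa [hx] using h x
      · intro h x
        by_cases hx : x ∈ b
        · simpa [hx] using h x hx
        · simpa [hx] using fun hxa => hx (hab hxa)
    rw [h]
    refine Finset.measurableSet_biInter b fun x _ => ?_
    have hx : MeasurableSet {c : Set H | x ∈ c} := (scottOpen_setOf_mem x).measurableSet
    by_cases hxa : x ∈ a
    · simpa [hxa] using hx
    · simp only [hxa, iff_false]
      exact hx.compl
  · have h : Atom (a : Set H) (b : Set H) = ∅ := by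
      refine eq_empty_of_forall_notMem fun c hc => hab ?_
      rw [← Finset.coe_subset, ← show c ∩ (b : Set H) = a from hc]
      exact inter_subset_right
    rw [h]
    exact MeasurableSet.empty

/-- The restriction `μ|b` is the image of `μ` under `c ↦ c ∩ b`. -/
theorem restrictMeas_apply {H : Type*} [DecidableEq H]
    (μ : @Measure (Set H) (scottBorel H)) (b : Finset H) {U : Set (Set H)}
    (hU : @MeasurableSet (Set H) (scottBorel H) U) :
    restrictMeas μ b U = μ {c | c ∩ ↑b ∈ U} := by
  classical
  let _ := scottBorel H
  have h : {c : Set H | c ∩ ↑b ∈ U} =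
      ⋃ a ∈ b.powerset.filter (fun a : Finset H => (a : Set H) ∈ U), Atom (↑a) (↑b) := by
    ext c
    simp only [mem_ofPred_eq, mem_iUnion, Finset.mem_filter, Finset.mem_powerset, Atom, exists_prop]
    constructor
    · intro hc
      refine ⟨b.filter (· ∈ c), ⟨Finset.filter_subset _ _, ?_⟩, ?_⟩
      · convert hc using 1
        ext x
        simp [and_comm]
      · ext x
        simp [and_comm]
    · rintro ⟨a, ⟨-, ha⟩, hc⟩
      rwa [hc]
  rw [h, measure_biUnion_finset]
  · simp only [restrictMeas, Measure.finsetSum_apply, Measure.smul_apply,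
      Measure.dirac_apply' _ hU, smul_eq_mul, Finset.sum_filter]
    refine Finset.sum_congr rfl fun a _ => ?_
    by_cases ha : (a : Set H) ∈ U <;> simp [ha]
  · intro a _ a' _ hne
    refine Set.disjoint_left.2 fun c hc hc' => hne ?_
    exact Finset.coe_injective ((show c ∩ ↑b = ↑a from hc).symm.trans hc')
  · exact fun a _ => measurableSet_atom a b

theorem ScottOpen.setOf_inter_mem_mono {H : Type*} {U : Set (Set H)} (hU : ScottOpen U) :
    Monotone fun b : Finset H => {c : Set H | c ∩ ↑b ∈ U} :=
  fun _ _ hb _ hc => hU.1 (inter_subset_inter_right _ (Finset.coe_subset.2 hb)) hc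

theorem ScottOpen.iUnion_setOf_inter_mem {H : Type*} {U : Set (Set H)} (hU : ScottOpen U) :
    ⋃ b : Finset H, {c : Set H | c ∩ ↑b ∈ U} = U := by
  classical
  ext c
  simp only [mem_iUnion, mem_ofPred_eq]
  refine ⟨fun ⟨b, hb⟩ => hU.1 inter_subset_left hb, fun hc => ?_⟩
  have hdir : DirectedOn (· ⊆ ·) (range fun b : Finset H => c ∩ ↑b) := by
    rintro _ ⟨b₁, rfl⟩ _ ⟨b₂, rfl⟩
    refine ⟨_, ⟨b₁ ∪ b₂, rfl⟩, ?_, ?_⟩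
    · exact inter_subset_inter_right _ (Finset.coe_subset.2 Finset.subset_union_left)
    · exact inter_subset_inter_right _ (Finset.coe_subset.2 Finset.subset_union_right)
  have hunion : ⋃₀ (range fun b : Finset H => c ∩ ↑b) = c := by
    refine Subset.antisymm (sUnion_subset ?_) fun x hx => ?_
    · rintro _ ⟨b, rfl⟩
      exact inter_subset_left
    · exact ⟨_, ⟨{x}, rfl⟩, hx, by simp⟩
  obtain ⟨_, ⟨b, rfl⟩, hb⟩ := hU.2 _ (range_nonempty _) hdir (by rwa [hunion])
  exact ⟨b, hb⟩

theorem restrictMeas_mono {H : Type*} [DecidableEq H]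
    (μ : @Measure (Set H) (scottBorel H)) {b₁ b₂ : Finset H} (hb : b₁ ⊆ b₂) :
    MeasLE (restrictMeas μ b₁) (restrictMeas μ b₂) := by
  intro U hU
  rw [restrictMeas_apply μ b₁ hU.measurableSet, restrictMeas_apply μ b₂ hU.measurableSet]
  exact measure_mono (hU.setOf_inter_mem_mono hb)

/-- The restrictions `μ|b` over finite `b` form a `⊑`-directed family of measures
below `μ` whose `⊑`-supremum is `μ`: every probability measure on `(Set H, 𝔅)` is the
directed supremum of finite discrete measures. -/
theorem restrict_directed_sup {H : Type*} [Countable H] [DecidableEq H]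
    (μ : @Measure (Set H) (scottBorel H))
    (hμ : @IsProbabilityMeasure (Set H) (scottBorel H) μ) :
    (∀ b₁ b₂ : Finset H, ∃ b₃ : Finset H,
      MeasLE (restrictMeas μ b₁) (restrictMeas μ b₃) ∧
      MeasLE (restrictMeas μ b₂) (restrictMeas μ b₃)) ∧
    (∀ b : Finset H, MeasLE (restrictMeas μ b) μ) ∧
    (∀ U : Set (Set H), ScottOpen U → μ U = ⨆ b : Finset H, restrictMeas μ b U) := by
  refine ⟨fun b₁ b₂ => ⟨b₁ ∪ b₂, restrictMeas_mono μ Finset.subset_union_left,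
    restrictMeas_mono μ Finset.subset_union_right⟩, fun b U hU => ?_, fun U hU => ?_⟩
  · rw [restrictMeas_apply μ b hU.measurableSet]
    exact measure_mono fun c hc => hU.1 inter_subset_left hc
  · simp only [restrictMeas_apply μ _ hU.measurableSet]
    rw [← hU.setOf_inter_mem_mono.directed_le.measure_iUnion, hU.iUnion_setOf_inter_mem]
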